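/- Consider the ABP system G_a with the forward channel under person-in-the-middle attack, with uncontrollable events Σ_uc = {send, done, timeout, deliver, p0, p1, a0, a1} and observable events Σ_o = {p0, p1, p0', p1', a0, a1, a0', a1'} with natural projection P. Let M = { s ∈ L(G_a) : the subsequence of s over {send, deliver} is not a prefix of the alternating sequence send, deliver, send, deliver, … }. Then: (i) M is controllable with respect to (L(G_a), Σ_uc); (ii) M is normal with respect to (L(G_a), P); and (iii) pr(M) = L(G_a), i.e., every string of L(G_a) can be extended within L(G_a) to a string of M. Hence the supremal controllable and normal sublanguage of M equals M itself, and a For-all attack on the safety property exists that never disables any event. -/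

import Mathlib

/-! Model of the Alternating Bit Protocol (ABP) as a synchronous composition of
finite-state automata, following Alur et al. and the paper's Section 4. -/

/-- Events of the ABP system. -/
inductive Ev
  | send | done | timeout | deliver
  | p0 | p1 | p0' | p1'
  | a0 | a1 | a0' | a1'
  deriving DecidableEq

/-- Sender states. -/
inductive SSt | s0 | s1 | s2 | s3 | s4 | s5 | s6 | s7 deriving DecidableEq
/-- Receiver states. -/
inductive RSt | r0 | r1 | r2 | r3 | r4 | r5 deriving DecidableEq
/-- Forward channel states. -/
inductive FSt | f0 | f1 | f2 deriving DecidableEq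
/-- Backward channel states. -/
inductive BSt | b0 | b1 | b2 deriving DecidableEq
/-- Sending client states. -/
inductive CSt | c0 | c1 deriving DecidableEq

/-- Sender (ABP sender) transitions. -/
def sndTrans : List (SSt × Ev × SSt) :=
  [(.s0, .a0', .s0), (.s0, .a1', .s0), (.s0, .timeout, .s0), (.s0, .send, .s1),
   (.s1, .p0, .s2), (.s2, .send, .s1), (.s2, .timeout, .s1), (.s2, .a1', .s2), (.s2, .a0', .s3),
   (.s3, .done, .s4), (.s4, .a0', .s4), (.s4, .timeout, .s4), (.s4, .send, .s5), (.s4, .a1', .s5),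
   (.s5, .p1, .s6), (.s6, .send, .s5), (.s6, .timeout, .s5), (.s6, .a1', .s7), (.s7, .done, .s0)]

/-- Receiver (ABP receiver) transitions. -/
def rcvTrans : List (RSt × Ev × RSt) :=
  [(.r0, .p0', .r1), (.r0, .p1', .r5), (.r1, .deliver, .r2), (.r2, .a0, .r3),
   (.r3, .p0', .r2), (.r3, .p1', .r4), (.r4, .deliver, .r0), (.r5, .a1, .r0)]

/-- Nominal (nondeterministic) forward channel transitions. -/
def fcTrans : List (FSt × Ev × FSt) :=
  [(.f0, .p0, .f0), (.f0, .p1, .f0), (.f0, .p0, .f1), (.f0, .p1, .f2),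
   (.f1, .p0, .f1), (.f1, .p1, .f1), (.f1, .p0', .f1), (.f1, .p0', .f0),
   (.f2, .p0, .f2), (.f2, .p1, .f2), (.f2, .p1', .f2), (.f2, .p1', .f0)]

/-- Nominal (nondeterministic) backward channel transitions. -/
def bcTrans : List (BSt × Ev × BSt) :=
  [(.b0, .a0, .b0), (.b0, .a1, .b0), (.b0, .a0, .b1), (.b0, .a1, .b2),
   (.b1, .a0, .b1), (.b1, .a1, .b1), (.b1, .a0', .b1), (.b1, .a0', .b0),
   (.b2, .a0, .b2), (.b2, .a1, .b2), (.b2, .a1', .b2), (.b2, .a1', .b0)]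

/-- Sending client transitions. -/
def scTrans : List (CSt × Ev × CSt) :=
  [(.c0, .done, .c0), (.c0, .send, .c1), (.c1, .done, .c0)]

/-- Component alphabets. -/
def sndAlph (e : Ev) : Prop := e ∈ ([.send, .done, .timeout, .p0, .p1, .a0', .a1'] : List Ev)
def rcvAlph (e : Ev) : Prop := e ∈ ([.deliver, .p0', .p1', .a0, .a1] : List Ev)
def fcAlph (e : Ev) : Prop := e ∈ ([.p0, .p1, .p0', .p1'] : List Ev)
def bcAlph (e : Ev) : Prop := e ∈ ([.a0, .a1, .a0', .a1'] : List Ev)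
def scAlph (e : Ev) : Prop := e ∈ ([.send, .done] : List Ev)

/-- Synchronization of one component: if the event is in the component's alphabet, the
component must execute a transition on it; otherwise the component does not move.
(The one-state receiving client with self-loop `deliver` and the one-state timer with
self-loop `timeout` never constrain nor change anything, so they are left implicit.) -/
def sync {Q : Type*} (alph : Ev → Prop) (trans : List (Q × Ev × Q))
    (q : Q) (e : Ev) (q' : Q) : Prop :=
  (alph e ∧ (q, e, q') ∈ trans) ∨ (¬ alph e ∧ q' = q)

/-- Global states of the ABP system. -/
structure GSt where
  snd : SSt
  rcv : RSt
  fc : FSt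
  bc : BSt
  sc : CSt
  deriving DecidableEq

/-- Global step of the synchronous composition, parametrized by the sender, forward
channel and sending-client transition lists (these vary across the setups). -/
def gstep (sT : List (SSt × Ev × SSt)) (fT : List (FSt × Ev × FSt))
    (cT : List (CSt × Ev × CSt)) (q : GSt) (e : Ev) (q' : GSt) : Prop :=
  sync sndAlph sT q.snd e q'.snd ∧
  sync rcvAlph rcvTrans q.rcv e q'.rcv ∧
  sync fcAlph fT q.fc e q'.fc ∧
  sync bcAlph bcTrans q.bc e q'.bc ∧
  sync scAlph cT q.sc e q'.sc

/-- Runs of the composition: `Reach step q0 s q` iff the string `s` can be executed from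
`q0`, ending in global state `q`. -/
inductive Reach (step : GSt → Ev → GSt → Prop) (q0 : GSt) : List Ev → GSt → Prop
  | nil : Reach step q0 [] q0
  | snoc {s : List Ev} {q : GSt} {e : Ev} {q' : GSt} :
      Reach step q0 s q → step q e q' → Reach step q0 (s ++ [e]) q'

/-- Initial global state. -/
def init : GSt := ⟨.s0, .r0, .f0, .b0, .c0⟩

/-- Generated language of the composition. -/
def Lang (step : GSt → Ev → GSt → Prop) : Set (List Ev) :=
  {s | ∃ q, Reach step init s q}

/-! Abstract supervisory-control notions on languages. -/

/-- Prefix closure `pr(K)`. -/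
def prefixClosure {A : Type*} (K : Set (List A)) : Set (List A) := {s | ∃ t ∈ K, s <+: t}

/-- Controllability of `K` w.r.t. `(L, Auc)`. -/
def IsControllable {A : Type*} (K L : Set (List A)) (Auc : Set A) : Prop :=
  ∀ s ∈ prefixClosure K, ∀ σ ∈ Auc, s ++ [σ] ∈ L → s ++ [σ] ∈ prefixClosure K

/-- Normality of `K` w.r.t. `(L, P)`: `pr(K) = P⁻¹(P(pr(K))) ∩ L`. -/
def IsNormalLang {A : Type*} (K L : Set (List A)) (P : List A → List A) : Prop :=
  prefixClosure K = {s | ∃ t ∈ prefixClosure K, P s = P t} ∩ L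

/-- Forward channel under the person-in-the-middle attack. -/
def fcTransAtk : List (FSt × Ev × FSt) :=
  fcTrans ++
  [(.f1, .p1', .f1), (.f1, .p1', .f0), (.f2, .p0', .f2), (.f2, .p0', .f0)]

/-- The attacked ABP system `G_a` (forward channel under attack). -/
def atkStep : GSt → Ev → GSt → Prop := gstep sndTrans fcTransAtk scTrans

/-- Uncontrollable events for the attacker. -/
def Euc : Set Ev :=
  {e | e ∈ ([.send, .done, .timeout, .deliver, .p0, .p1, .a0, .a1] : List Ev)}

/-- Natural projection onto the attacker's observable events
`Eo = {p0, p1, p0', p1', a0, a1, a0', a1'}`. -/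
def P (s : List Ev) : List Ev :=
  s.filter (fun e => decide (e ∈ ([.p0, .p1, .p0', .p1', .a0, .a1, .a0', .a1'] : List Ev)))

/-- The attacker's specification language: strings of `L(G_a)` whose `{send, deliver}`
subsequence is *not* a prefix of the alternating sequence `send, deliver, send, …`. -/
def M : Set (List Ev) :=
  {s | s ∈ Lang atkStep ∧
    ¬ ∃ n : ℕ,
        s.filter (fun e => decide (e = Ev.send ∨ e = Ev.deliver)) <+:
          (List.replicate n [Ev.send, Ev.deliver]).flatten}

instance (e : Ev) : Decidable (sndAlph e) := inferInstanceAs (Decidable (e ∈ _))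
instance (e : Ev) : Decidable (rcvAlph e) := inferInstanceAs (Decidable (e ∈ _))
instance (e : Ev) : Decidable (fcAlph e) := inferInstanceAs (Decidable (e ∈ _))
instance (e : Ev) : Decidable (bcAlph e) := inferInstanceAs (Decidable (e ∈ _))
instance (e : Ev) : Decidable (scAlph e) := inferInstanceAs (Decidable (e ∈ _))

theorem Reach.trans {step : GSt → Ev → GSt → Prop} {q₀ q₁ q₂ : GSt} {s t : List Ev}
    (hs : Reach step q₀ s q₁) (ht : Reach step q₁ t q₂) : Reach step q₀ (s ++ t) q₂ := by
  induction ht with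
  | nil => simpa using hs
  | snoc _ hstep ih => simpa only [List.append_assoc] using ih.snoc hstep

theorem Reach.cons {step : GSt → Ev → GSt → Prop} {q₀ q₁ q₂ : GSt} {e : Ev} {t : List Ev}
    (he : step q₀ e q₁) (ht : Reach step q₁ t q₂) : Reach step q₀ (e :: t) q₂ :=
  Reach.trans (.snoc .nil he) ht

theorem mem_lang_of_prefix {step : GSt → Ev → GSt → Prop} {s t : List Ev}
    (hs : s ∈ Lang step) (hts : t <+: s) : t ∈ Lang step := by
  obtain ⟨q, hq⟩ := hs
  induction hq with
  | nil => exact ⟨init, List.prefix_nil.mp hts ▸ .nil⟩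
  | snoc hr hstep ih =>
    rcases List.prefix_concat_iff.mp hts with rfl | h
    · exact ⟨_, hr.snoc hstep⟩
    · exact ih h

/-- A sender waiting for a new message has a client that is ready to send. -/
def ClientReady (q : GSt) : Prop := q.snd = .s0 ∨ q.snd = .s4 → q.sc = .c0

theorem ClientReady.step {q q' : GSt} {e : Ev} (hq : ClientReady q) (h : atkStep q e q') :
    ClientReady q' := by
  have key : ∀ x ∈ sndTrans, x.2.2 = .s0 ∨ x.2.2 = .s4 →
      x.2.1 = .done ∨ (¬ scAlph x.2.1 ∧ x.1 = x.2.2) := by decide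
  have key_client : ∀ x ∈ scTrans, x.2.1 = .done → x.2.2 = .c0 := by decide
  have sub : ¬ sndAlph e → ¬ scAlph e := by cases e <;> decide
  obtain ⟨hs, -, -, -, hc⟩ := h
  intro hq'
  have hstay (he : ¬ scAlph e) (hsnd : q.snd = q'.snd) : q'.sc = .c0 := by
    rw [(hc.resolve_left fun h => he h.1).2]
    exact hq (hsnd ▸ hq')
  rcases hs with ⟨-, hs⟩ | ⟨he, hs⟩
  · rcases key _ hs hq' with rfl | ⟨he, hsnd⟩
    · exact key_client _ (hc.resolve_right fun h => h.1 (by decide)).2 rfl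
    · exact hstay he hsnd
  · exact hstay (sub he) hs.symm

theorem Reach.clientReady {s : List Ev} {q : GSt} (h : Reach atkStep init s q) :
    ClientReady q := by
  induction h with
  | nil => exact fun _ => rfl
  | snoc _ hstep ih => exact ih.step hstep

/-- Transitions of the sender and its client alone, leaving the other components fixed. -/
theorem atkStep_sender {s s' : SSt} {c c' : CSt} {e : Ev} (r : RSt) (f : FSt) (b : BSt)
    (h : e ∈ ([.send, .done, .timeout] : List Ev)) (hs : (s, e, s') ∈ sndTrans)
    (hc : sync scAlph scTrans c e c') :
    atkStep ⟨s, r, f, b, c⟩ e ⟨s', r, f, b, c'⟩ := by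
  refine ⟨.inl ⟨?_, hs⟩, .inr ⟨?_, rfl⟩, .inr ⟨?_, rfl⟩, .inr ⟨?_, rfl⟩, hc⟩ <;>
    clear hs hc <;> revert e <;> simp [sndAlph, rcvAlph, fcAlph, bcAlph]

/-- Every reachable state can be driven to one where the forward channel holds a packet. -/
theorem exists_reach_loaded {q : GSt} (hq : ClientReady q) :
    ∃ t q', Reach atkStep q t q' ∧ q'.fc ≠ .f0 := by
  obtain ⟨s, r, f, b, c⟩ := q
  by_cases hf : f = .f0
  swap
  · exact ⟨[], _, .nil, hf⟩
  subst hf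
  have h1 (c : CSt) : ∃ t q', Reach atkStep ⟨.s1, r, .f0, b, c⟩ t q' ∧ q'.fc ≠ .f0 :=
    have h : atkStep ⟨.s1, r, .f0, b, c⟩ .p0 ⟨.s2, r, .f1, b, c⟩ :=
      ⟨.inl (by simp only; decide), .inr ⟨by decide, rfl⟩, .inl (by simp only; decide),
        .inr ⟨by decide, rfl⟩, .inr ⟨by decide, rfl⟩⟩
    ⟨[.p0], _, .cons h .nil, nofun⟩
  have h5 (c : CSt) : ∃ t q', Reach atkStep ⟨.s5, r, .f0, b, c⟩ t q' ∧ q'.fc ≠ .f0 :=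
    have h : atkStep ⟨.s5, r, .f0, b, c⟩ .p1 ⟨.s6, r, .f2, b, c⟩ :=
      ⟨.inl (by simp only; decide), .inr ⟨by decide, rfl⟩, .inl (by simp only; decide),
        .inr ⟨by decide, rfl⟩, .inr ⟨by decide, rfl⟩⟩
    ⟨[.p1], _, .cons h .nil, nofun⟩
  have pre {q q' : GSt} {e : Ev} (he : atkStep q e q')
      (h : ∃ t p, Reach atkStep q' t p ∧ p.fc ≠ .f0) :
      ∃ t p, Reach atkStep q t p ∧ p.fc ≠ .f0 :=
    let ⟨t, p, ht, hp⟩ := h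
    ⟨e :: t, p, .cons he ht, hp⟩
  have h0 := pre (atkStep_sender (s := .s0) (c := .c0) (e := .send) r .f0 b (by decide)
    (by decide) (.inl (by decide))) (h1 .c1)
  have h4 := pre (atkStep_sender (s := .s4) (c := .c0) (e := .send) r .f0 b (by decide)
    (by decide) (.inl (by decide))) (h5 .c1)
  have hdone : sync scAlph scTrans c .done .c0 := by
    cases c <;> exact .inl (by decide)
  have htimeout : sync scAlph scTrans c .timeout c := .inr ⟨by decide, rfl⟩
  cases s with
  | s0 => obtain rfl : c = .c0 := hq (.inl rfl); exact h0
  | s1 => exact h1 c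
  | s2 => exact pre (atkStep_sender r .f0 b (by decide) (by decide) htimeout) (h1 c)
  | s3 => exact pre (atkStep_sender r .f0 b (by decide) (by decide) hdone) h4
  | s4 => obtain rfl : c = .c0 := hq (.inr rfl); exact h4
  | s5 => exact h5 c
  | s6 => exact pre (atkStep_sender r .f0 b (by decide) (by decide) htimeout) (h5 c)
  | s7 => exact pre (atkStep_sender r .f0 b (by decide) (by decide) hdone) h0

/-- With a packet in the attacked forward channel, the receiver can make any of its moves while
every other component stays fixed. -/
theorem atkStep_receiver {q : GSt} (hf : q.fc ≠ .f0) {r r' : RSt} {e : Ev}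
    (h : (r, e, r') ∈ rcvTrans) :
    atkStep { q with rcv := r } e { q with rcv := r' } := by
  obtain ⟨s, _, f, b, c⟩ := q
  have hr : rcvAlph e := by
    simp only [rcvTrans, List.mem_cons, Prod.mk.injEq, List.not_mem_nil, or_false] at h
    rcases h with h | h | h | h | h | h | h | h <;> rw [h.2.1] <;> decide
  have hfc : sync fcAlph fcTransAtk f e f := by
    cases e <;> cases f <;> first
      | exact absurd hr (by decide)
      | exact absurd rfl hf
      | exact .inl (by decide)
      | exact .inr ⟨by decide, rfl⟩
  have hbc : sync bcAlph bcTrans b e b := by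
    cases e <;> cases b <;> first
      | exact absurd hr (by decide)
      | exact .inl (by decide)
      | exact .inr ⟨by decide, rfl⟩
  refine ⟨.inr ⟨?_, rfl⟩, .inl ⟨hr, h⟩, hfc, hbc, .inr ⟨?_, rfl⟩⟩ <;>
    clear h hfc hbc <;> cases e <;> revert hr <;> decide

/-- With a packet in the attacked forward channel, the receiver can deliver twice in a row. -/
theorem exists_reach_deliver_deliver {q : GSt} (hf : q.fc ≠ .f0) :
    ∃ t q', Reach atkStep q (t ++ [.p0', .deliver, .a0, .p1', .deliver]) q' := by
  have fin : Reach atkStep { q with rcv := .r0 } [.p0', .deliver, .a0, .p1', .deliver]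
      { q with rcv := .r0 } :=
    .cons (atkStep_receiver hf (r' := .r1) (by decide)) <|
    .cons (atkStep_receiver hf (r' := .r2) (by decide)) <|
    .cons (atkStep_receiver hf (r' := .r3) (by decide)) <|
    .cons (atkStep_receiver hf (r' := .r4) (by decide)) <|
    .cons (atkStep_receiver hf (by decide)) .nil
  suffices h : ∀ r, ∃ t, Reach atkStep { q with rcv := r } t { q with rcv := .r0 } from
    let ⟨t, ht⟩ := h q.rcv
    ⟨t, _, ht.trans fin⟩
  have h4 : Reach atkStep { q with rcv := .r4 } [.deliver] { q with rcv := .r0 } :=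
    .cons (atkStep_receiver hf (by decide)) .nil
  have h3 := Reach.cons (atkStep_receiver hf (r := .r3) (e := .p1') (by decide)) h4
  have h2 := Reach.cons (atkStep_receiver hf (r := .r2) (e := .a0) (by decide)) h3
  have h1 := Reach.cons (atkStep_receiver hf (r := .r1) (e := .deliver) (by decide)) h2
  have h5 : Reach atkStep { q with rcv := .r5 } [.a1] { q with rcv := .r0 } :=
    .cons (atkStep_receiver hf (by decide)) .nil
  intro r
  cases r with
  | r0 => exact ⟨_, .nil⟩
  | r1 => exact ⟨_, h1⟩
  | r2 => exact ⟨_, h2⟩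
  | r3 => exact ⟨_, h3⟩
  | r4 => exact ⟨_, h4⟩
  | r5 => exact ⟨_, h5⟩

theorem isChain_ne_flatten_replicate (n : ℕ) :
    List.IsChain (· ≠ ·) (List.replicate n [Ev.send, Ev.deliver]).flatten := by
  induction n with
  | zero => exact .nil
  | succ n ih => cases n <;> simp_all [List.replicate_succ]

theorem not_alternating_append_deliver_deliver (s : List Ev) (n : ℕ) :
    ¬ s ++ [Ev.deliver, Ev.deliver] <+: (List.replicate n [Ev.send, Ev.deliver]).flatten := by
  intro h
  have hc := ((isChain_ne_flatten_replicate n).prefix h).right_of_append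
  simp at hc

theorem prefixClosure_M : prefixClosure M = Lang atkStep := by
  refine Set.Subset.antisymm (fun s ⟨t, ht, hst⟩ => mem_lang_of_prefix ht.1 hst) ?_
  rintro s ⟨q, hq⟩
  obtain ⟨t, q₁, ht, hf⟩ := exists_reach_loaded hq.clientReady
  obtain ⟨u, q₂, hu⟩ := exists_reach_deliver_deliver hf
  refine ⟨_, ⟨⟨q₂, hq.trans (ht.trans hu)⟩, ?_⟩, List.prefix_append _ _⟩
  rintro ⟨n, hn⟩
  refine not_alternating_append_deliver_deliver
    ((s ++ (t ++ u)).filter fun e => decide (e = Ev.send ∨ e = Ev.deliver)) n ?_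
  simpa using hn

/-- the safety-violation language `M` is (i) controllable w.r.t.
`(L(G_a), Euc)`, (ii) normal w.r.t. `(L(G_a), P)`, and (iii) `pr(M) = L(G_a)`; hence
`supCN(M) = M` and a For-all attack on the safety property exists that never disables
any event. -/
theorem stmt8 :
    IsControllable M (Lang atkStep) Euc ∧
    IsNormalLang M (Lang atkStep) P ∧
    prefixClosure M = Lang atkStep := by
  refine ⟨?_, ?_, prefixClosure_M⟩
  · intro s _ σ _ hσ
    rwa [prefixClosure_M]
  · rw [IsNormalLang, prefixClosure_M]
    ext s
    exact ⟨fun hs => ⟨⟨s, hs, rfl⟩, hs⟩, fun hs => hs.2⟩
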